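/- Let ψ : ℝ → ℝ be continuously differentiable with |ψ| and |ψ'| bounded by a polynomial, and let Z be a standard real Gaussian random variable. Define G(u) = E[ψ(√u · Z)²] for u > 0. Then G is differentiable on (0, ∞) with G'(u) = E[(Z² − 1)·ψ(√u · Z)²] / (2u) for every u > 0. -/

import Mathlib

open Real MeasureTheory Set

/-- Standard Gaussian probability density function. -/
noncomputable def gpdf (x : ℝ) : ℝ := (Real.sqrt (2 * Real.pi))⁻¹ * Real.exp (-(x ^ 2) / 2)

theorem continuous_gpdf : Continuous gpdf := by
  unfold gpdf
  fun_prop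

theorem gpdf_nonneg (x : ℝ) : 0 ≤ gpdf x := by
  unfold gpdf
  positivity

theorem hasDerivAt_gpdf (x : ℝ) : HasDerivAt gpdf (-x * gpdf x) x := by
  have h : HasDerivAt (fun y : ℝ => -(y ^ 2) / 2) (-x) x :=
    ((hasDerivAt_pow 2 x).neg.div_const 2).congr_deriv (by norm_num; ring)
  exact (h.exp.const_mul (Real.sqrt (2 * Real.pi))⁻¹).congr_deriv (by unfold gpdf; ring)

theorem integrable_one_add_abs_pow_mul_gpdf (m : ℕ) :
    Integrable (fun x : ℝ => (1 + |x|) ^ m * gpdf x) := by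
  have hpow (k : ℕ) : Integrable (fun x : ℝ => |x| ^ k * gpdf x) := by
    have hk : (-1 : ℝ) < k := by linarith [k.cast_nonneg (α := ℝ)]
    refine ((integrable_rpow_mul_exp_neg_mul_sq (b := 1 / 2) (by norm_num) hk).norm.const_mul
      (Real.sqrt (2 * Real.pi))⁻¹).congr (ae_of_all _ fun x => ?_)
    simp only [gpdf, Real.rpow_natCast, norm_mul, norm_pow, Real.norm_eq_abs, Real.abs_exp]
    ring_nf
  refine (((hpow 0).add (hpow m)).const_mul (2 ^ (m - 1))).mono'
    ((by fun_prop : Continuous fun x : ℝ => (1 + |x|) ^ m).mul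
      continuous_gpdf).aestronglyMeasurable (ae_of_all _ fun x => ?_)
  rw [Real.norm_of_nonneg (mul_nonneg (by positivity) (gpdf_nonneg x))]
  have h := mul_le_mul_of_nonneg_right
    (add_pow_le zero_le_one (abs_nonneg x) m) (gpdf_nonneg x)
  simp only [one_pow] at h
  simp only [Pi.add_apply, pow_zero]
  linarith

theorem integrable_mul_gpdf {f : ℝ → ℝ} (hf : Continuous f) {C : ℝ} {m : ℕ}
    (hb : ∀ x, |f x| ≤ C * (1 + |x|) ^ m) : Integrable (fun x => f x * gpdf x) := by
  refine ((integrable_one_add_abs_pow_mul_gpdf m).const_mul C).mono'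
    (hf.mul continuous_gpdf).aestronglyMeasurable (ae_of_all _ fun x => ?_)
  rw [norm_mul, Real.norm_eq_abs, Real.norm_of_nonneg (gpdf_nonneg x), ← mul_assoc]
  exact mul_le_mul_of_nonneg_right (hb x) (gpdf_nonneg x)

theorem abs_comp_mul_le {f : ℝ → ℝ} {c : ℝ} (hc : 0 ≤ c) {n : ℕ}
    (hb : ∀ x, |f x| ≤ c * (1 + |x|) ^ n) {t K : ℝ} (ht : |t| ≤ K) (z : ℝ) :
    |f (t * z)| ≤ c * (1 + K) ^ n * (1 + |z|) ^ n := by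
  have hK : 0 ≤ K := (abs_nonneg t).trans ht
  refine (hb _).trans ?_
  rw [mul_assoc, ← mul_pow]
  gcongr
  rw [abs_mul]
  nlinarith [abs_nonneg z, mul_le_mul_of_nonneg_right ht (abs_nonneg z)]

/-- Gaussian integration by parts applied to `z * φ z ^ 2`, for `φ z = ψ (s * z)`. -/
theorem integral_sq_sub_one_mul_comp_mul_sq_mul_gpdf {ψ : ℝ → ℝ} (hψ : ContDiff ℝ 1 ψ)
    {c : ℝ} (hc : 0 ≤ c) {n : ℕ} (hb : ∀ x, |ψ x| ≤ c * (1 + |x|) ^ n)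
    (hb' : ∀ x, |deriv ψ x| ≤ c * (1 + |x|) ^ n) (s : ℝ) :
    ∫ z, (z ^ 2 - 1) * ψ (s * z) ^ 2 * gpdf z =
      2 * s * ∫ z, z * ψ (s * z) * deriv ψ (s * z) * gpdf z := by
  have hcont : Continuous ψ := hψ.continuous
  have hcont' : Continuous (deriv ψ) := hψ.continuous_deriv le_rfl
  set A := c * (1 + |s|) ^ n
  have hA : 0 ≤ A := by positivity
  have b (z : ℝ) : |ψ (s * z)| ≤ A * (1 + |z|) ^ n := abs_comp_mul_le hc hb le_rfl z
  have b' (z : ℝ) : |deriv ψ (s * z)| ≤ A * (1 + |z|) ^ n := abs_comp_mul_le hc hb' le_rfl z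
  have hz (z : ℝ) : |z| ≤ 1 + |z| := by linarith
  have i0 : Integrable (fun z => z * ψ (s * z) ^ 2 * gpdf z) :=
    integrable_mul_gpdf (by fun_prop) (C := A ^ 2) (m := 2 * n + 1) fun z => by
      rw [abs_mul, abs_pow]
      calc |z| * |ψ (s * z)| ^ 2 ≤ (1 + |z|) * (A * (1 + |z|) ^ n) ^ 2 := by
            gcongr <;> first | exact hz z | exact b z
        _ = _ := by ring
  have i1 : Integrable (fun z => (z ^ 2 - 1) * ψ (s * z) ^ 2 * gpdf z) :=
    integrable_mul_gpdf (by fun_prop) (C := A ^ 2) (m := 2 * n + 2) fun z => by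
      rw [abs_mul, abs_pow]
      have h : |z ^ 2 - 1| ≤ (1 + |z|) ^ 2 := by
        rw [abs_le]
        constructor <;> nlinarith [abs_nonneg z, sq_abs z]
      calc |z ^ 2 - 1| * |ψ (s * z)| ^ 2 ≤ (1 + |z|) ^ 2 * (A * (1 + |z|) ^ n) ^ 2 := by
            gcongr; exact b z
        _ = _ := by ring
  have i2 : Integrable (fun z => z * ψ (s * z) * deriv ψ (s * z) * gpdf z) :=
    integrable_mul_gpdf (by fun_prop) (C := A ^ 2) (m := 2 * n + 1) fun z => by
      rw [abs_mul, abs_mul]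
      calc |z| * |ψ (s * z)| * |deriv ψ (s * z)|
          ≤ (1 + |z|) * (A * (1 + |z|) ^ n) * (A * (1 + |z|) ^ n) := by
            gcongr <;> first | exact hz z | exact b z | exact b' z
        _ = _ := by ring
  have key := integral_eq_zero_of_hasDerivAt_of_integrable
    (f := fun z => z * ψ (s * z) ^ 2 * gpdf z)
    (f' := fun z => 2 * s * (z * ψ (s * z) * deriv ψ (s * z) * gpdf z)
      - (z ^ 2 - 1) * ψ (s * z) ^ 2 * gpdf z) (fun z => by
      have hd : HasDerivAt (fun z => ψ (s * z)) (deriv ψ (s * z) * s) z :=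
        ((hψ.differentiable one_ne_zero) (s * z)).hasDerivAt.comp z
          (((hasDerivAt_id z).const_mul s).congr_deriv (mul_one s))
      exact (((hasDerivAt_id z).mul (hd.pow 2)).mul (hasDerivAt_gpdf z)).congr_deriv
        (by simp; ring))
    ((i2.const_mul _).sub i1) i0
  rw [integral_sub (i2.const_mul _) i1, integral_const_mul] at key
  linarith

/-- For `ψ` continuously differentiable with `|ψ|` and `|ψ'|` polynomially bounded, and
a standard Gaussian `Z`, the function `G(u) = E[ψ(√u·Z)²]` is differentiable on
`(0, ∞)` with `G'(u) = E[(Z² − 1)·ψ(√u·Z)²]/(2u)`. -/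
theorem sq_norm_hasDerivAt (ψ : ℝ → ℝ) (hψ : ContDiff ℝ 1 ψ)
    (c : ℝ) (hc : 0 < c) (n : ℕ)
    (hb : ∀ x : ℝ, |ψ x| ≤ c * (1 + |x|) ^ n)
    (hb' : ∀ x : ℝ, |deriv ψ x| ≤ c * (1 + |x|) ^ n) :
    ∀ u ∈ Set.Ioi (0 : ℝ),
      HasDerivAt
        (fun v : ℝ => ∫ z : ℝ, (ψ (Real.sqrt v * z)) ^ 2 * gpdf z)
        ((∫ z : ℝ, (z ^ 2 - 1) * (ψ (Real.sqrt u * z)) ^ 2 * gpdf z) / (2 * u))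
        u := by
  intro u hu
  rw [mem_Ioi] at hu
  have hcont : Continuous ψ := hψ.continuous
  have hcont' : Continuous (deriv ψ) := hψ.continuous_deriv le_rfl
  set A := c * (1 + Real.sqrt (2 * u)) ^ n
  have hA : 0 ≤ A := by positivity
  have hr : 0 < Real.sqrt (u / 2) := Real.sqrt_pos.2 (by positivity)
  have hsu : 0 < Real.sqrt u := Real.sqrt_pos.2 hu
  have hsqrt (v : ℝ) (hv : v ∈ Ioo (u / 2) (2 * u)) : |Real.sqrt v| ≤ Real.sqrt (2 * u) := by
    rw [abs_of_nonneg (Real.sqrt_nonneg v)]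
    exact Real.sqrt_le_sqrt hv.2.le
  have hmem : u ∈ Ioo (u / 2) (2 * u) := ⟨by linarith, by linarith⟩
  have main := (hasDerivAt_integral_of_dominated_loc_of_deriv_le (μ := volume) (x₀ := u)
    (s := Ioo (u / 2) (2 * u))
    (F := fun v z => ψ (Real.sqrt v * z) ^ 2 * gpdf z)
    (F' := fun v z =>
      (Real.sqrt v)⁻¹ * (z * ψ (Real.sqrt v * z) * deriv ψ (Real.sqrt v * z) * gpdf z))
    (bound := fun z => (Real.sqrt (u / 2))⁻¹ * A ^ 2 * ((1 + |z|) ^ (2 * n + 1) * gpdf z))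
    (isOpen_Ioo.mem_nhds hmem) ?_ ?_ ?_ ?_ ?_ ?_).2
  · refine main.congr_deriv ?_
    rw [integral_const_mul,
      integral_sq_sub_one_mul_comp_mul_sq_mul_gpdf hψ hc.le hb hb' (Real.sqrt u)]
    have hss : u = Real.sqrt u * Real.sqrt u := (Real.mul_self_sqrt hu.le).symm
    rw [eq_div_iff (by positivity)]
    generalize (∫ z, z * ψ (Real.sqrt u * z) * deriv ψ (Real.sqrt u * z) * gpdf z) = I
    nth_rewrite 2 [hss]
    field_simp
  · exact Filter.Eventually.of_forall fun v =>
      ((by fun_prop : Continuous fun z => ψ (Real.sqrt v * z) ^ 2).mul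
        continuous_gpdf).aestronglyMeasurable
  · refine integrable_mul_gpdf (by fun_prop) (C := A ^ 2) (m := 2 * n) fun z => ?_
    rw [abs_pow]
    calc |ψ (Real.sqrt u * z)| ^ 2 ≤ (A * (1 + |z|) ^ n) ^ 2 := by
          gcongr; exact abs_comp_mul_le hc.le hb (hsqrt u hmem) z
      _ = _ := by ring
  · exact (((by fun_prop : Continuous fun z =>
      z * ψ (Real.sqrt u * z) * deriv ψ (Real.sqrt u * z)).mul
        continuous_gpdf).const_mul _).aestronglyMeasurable
  · refine ae_of_all _ fun z v hv => ?_
    have h1 := abs_comp_mul_le hc.le hb (hsqrt v hv) z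
    have h2 := abs_comp_mul_le hc.le hb' (hsqrt v hv) z
    have h3 : |z| ≤ 1 + |z| := by linarith
    have h4 : Real.sqrt (u / 2) ≤ Real.sqrt v := Real.sqrt_le_sqrt hv.1.le
    have hg := gpdf_nonneg z
    simp only [norm_mul, norm_inv, Real.norm_eq_abs, abs_of_nonneg hg,
      abs_of_nonneg (Real.sqrt_nonneg v)]
    calc (Real.sqrt v)⁻¹ * (|z| * |ψ (Real.sqrt v * z)| * |deriv ψ (Real.sqrt v * z)| * gpdf z)
        ≤ (Real.sqrt (u / 2))⁻¹ *
          ((1 + |z|) * (A * (1 + |z|) ^ n) * (A * (1 + |z|) ^ n) * gpdf z) := by gcongr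
      _ = _ := by ring
  · exact (integrable_one_add_abs_pow_mul_gpdf _).const_mul _
  · refine ae_of_all _ fun z v hv => ?_
    have hv0 : 0 < v := by linarith [hv.1]
    have hd : HasDerivAt (fun v => ψ (Real.sqrt v * z))
        (deriv ψ (Real.sqrt v * z) * (1 / (2 * Real.sqrt v) * z)) v :=
      ((hψ.differentiable one_ne_zero) (Real.sqrt v * z)).hasDerivAt.comp v
        ((Real.hasDerivAt_sqrt hv0.ne').mul_const z)
    have hsv : Real.sqrt v ≠ 0 := (Real.sqrt_pos.2 hv0).ne'
    exact ((hd.pow 2).mul_const (gpdf z)).congr_deriv (by norm_num; field_simp)
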